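/- arXiv:1811.01878 — 4 statements merged into one kernel-verified Lean document; each statement's English description precedes it below -/
import Mathlib

section
/- Let K and H be complex Hilbert spaces, z ∈ ℂ with Im z ≠ 0, G ∈ B(K, H) an injective bounded operator, and Q ∈ B(K) a bounded operator satisfying Q − Q* = (z − z̄)·G*G. Let L be a densely defined selfadjoint operator in K. If h belongs to the domain of L and Qh + Lh = 0, then h = 0; that is, the kernel of Q + L (defined on the domain of L) is trivial. -/
open InnerProductSpace MeasureTheory Complex

theorem ker_Q_add_L_trivial
    {K H : Type*} [NormedAddCommGroup K] [InnerProductSpace ℂ K] [CompleteSpace K]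
    [NormedAddCommGroup H] [InnerProductSpace ℂ H] [CompleteSpace H]
    (z : ℂ) (hz : z.im ≠ 0)
    (G : K →L[ℂ] H) (hGinj : Function.Injective G)
    (Q : K →L[ℂ] K)
    (hQ : Q - ContinuousLinearMap.adjoint Q =
      (z - (starRingEnd ℂ) z) • ((ContinuousLinearMap.adjoint G).comp G))
    (L : K →ₗ.[ℂ] K) (hLdense : Dense (L.domain : Set K)) (hLsa : IsSelfAdjoint L) :
    ∀ h : L.domain, Q (h : K) + L h = 0 → (h : K) = 0 := by
  intro h hh
  have hsym : inner ℂ (L h) (h : K) = inner ℂ (h : K) (L h) := by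
    have hformal := L.adjoint_isFormalAdjoint hLdense
    rw [LinearPMap.isSelfAdjoint_def.mp hLsa] at hformal
    exact hformal h h
  rw [eq_neg_of_add_eq_zero_right hh, inner_neg_left, inner_neg_right, neg_inj] at hsym
  have hQh := congrArg (fun T : K →L[ℂ] K => inner ℂ (h : K) (T h)) hQ
  simp only [sub_apply, smul_apply,
    ContinuousLinearMap.comp_apply, inner_sub_right, inner_smul_right,
    ContinuousLinearMap.adjoint_inner_right, hsym, sub_self] at hQh
  have hzne : z - (starRingEnd ℂ) z ≠ 0 := fun hz0 =>
    hz (Complex.conj_eq_iff_im.mp (sub_eq_zero.mp hz0).symm)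
  have hGh : G h = 0 := inner_self_eq_zero.mp ((mul_eq_zero.mp hQh.symm).resolve_left hzne)
  exact hGinj (hGh.trans (map_zero G).symm)
end

section
/- For all z₁, z₂ ∈ ℂ ∖ [0, ∞), with √z denoting the branch of the square root with Im √z > 0, the following integral identity holds: ∫_{ℝ³} e^{i(√z₁ + √z₂)|x|} / (16π²|x|²) dx = i / (4π(√z₁ + √z₂)). Consequently, for z₁ ≠ z₂, (z₁ − z₂) · ∫_{ℝ³} (e^{i√z₁|x|}/(4π|x|)) · (e^{i√z₂|x|}/(4π|x|)) dx = i√z₁/(4π) − i√z₂/(4π). -/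
open InnerProductSpace MeasureTheory Complex

/-- The branch of the complex square root with positive imaginary part,
defined off the ray `[0, ∞)`. -/
noncomputable def sqrtB (z : ℂ) : ℂ := Complex.I * (-z) ^ ((1 : ℂ) / 2)

theorem sqrtB_sq (z : ℂ) : sqrtB z ^ 2 = z := by
  have h : ((-z) ^ ((1 : ℂ) / 2)) ^ 2 = -z := by
    rw [one_div]
    exact_mod_cast Complex.cpow_nat_inv_pow (-z) (n := 2) two_ne_zero
  rw [sqrtB, mul_pow, h, Complex.I_sq]
  ring

theorem sqrtB_im_pos {z : ℂ} (hz : ¬(z.im = 0 ∧ 0 ≤ z.re)) : 0 < (sqrtB z).im := by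
  have hslit : -z ∈ Complex.slitPlane := by
    rw [Complex.mem_slitPlane_iff]
    by_contra! h
    simp only [Complex.neg_re, Complex.neg_im, neg_eq_zero] at h
    exact hz ⟨h.2, by linarith [h.1]⟩
  have harg : (-z).arg < Real.pi :=
    lt_of_le_of_ne (Complex.arg_le_pi _) (Complex.mem_slitPlane_iff_arg.1 hslit).1
  have him : (Complex.log (-z) * ((1 : ℂ) / 2)).im = (-z).arg / 2 := by
    rw [show (1 : ℂ) / 2 = ((1 / 2 : ℝ) : ℂ) by norm_num, Complex.im_mul_ofReal, Complex.log_im]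
    ring
  rw [sqrtB, Complex.I_mul_im, Complex.cpow_def_of_ne_zero (Complex.slitPlane_ne_zero hslit),
    Complex.exp_re, him]
  refine mul_pos (Real.exp_pos _) (Real.cos_pos_of_mem_Ioo ⟨?_, ?_⟩)
  · linarith [Complex.neg_pi_lt_arg (-z)]
  · linarith

theorem integral_exp_I_mul_norm_div_norm_sq {w : ℂ} (hw : 0 < w.im) :
    ∫ x : EuclideanSpace ℝ (Fin 3),
        Complex.exp (Complex.I * w * (‖x‖ : ℂ)) / (16 * (Real.pi : ℂ) ^ 2 * (‖x‖ : ℂ) ^ 2)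
      = Complex.I / (4 * (Real.pi : ℂ) * w) := by
  have hw0 : w ≠ 0 := by
    rintro rfl
    simp at hw
  have hpi : (Real.pi : ℂ) ≠ 0 := by exact_mod_cast Real.pi_ne_zero
  have hball : (volume : Measure (EuclideanSpace ℝ (Fin 3))).real (Metric.ball 0 1)
      = Real.pi * 4 / 3 := by
    rw [Measure.real, EuclideanSpace.volume_ball_fin_three, ENNReal.ofReal_one, one_pow, one_mul,
      ENNReal.toReal_ofReal (by positivity)]
  have hradial : ∫ r in Set.Ioi (0 : ℝ), r ^ (3 - 1) •
        (Complex.exp (Complex.I * w * (r : ℂ)) / (16 * (Real.pi : ℂ) ^ 2 * (r : ℂ) ^ 2))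
      = Complex.I / w / (16 * (Real.pi : ℂ) ^ 2) := by
    calc
      _ = ∫ r in Set.Ioi (0 : ℝ),
            Complex.exp (Complex.I * w * (r : ℂ)) / (16 * (Real.pi : ℂ) ^ 2) := by
        refine setIntegral_congr_fun measurableSet_Ioi fun r hr => ?_
        have hr0 : (r : ℂ) ≠ 0 := by exact_mod_cast (ne_of_gt hr)
        simp only [Complex.real_smul]
        push_cast
        field_simp
      _ = _ := by
        rw [integral_div, integral_exp_mul_complex_Ioi (by simpa using hw)]
        congr 1
        simp only [Complex.ofReal_zero, mul_zero, Complex.exp_zero]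
        field_simp
        simp
  have h := integral_fun_norm_addHaar (volume : Measure (EuclideanSpace ℝ (Fin 3)))
    fun r : ℝ => Complex.exp (Complex.I * w * (r : ℂ)) / (16 * (Real.pi : ℂ) ^ 2 * (r : ℂ) ^ 2)
  rw [finrank_euclideanSpace_fin, hball, hradial] at h
  rw [h, nsmul_eq_mul, Complex.real_smul]
  push_cast
  field_simp
  norm_num

theorem green_kernel_inner_product_identity
    (z₁ z₂ : ℂ) (hz₁ : ¬(z₁.im = 0 ∧ 0 ≤ z₁.re)) (hz₂ : ¬(z₂.im = 0 ∧ 0 ≤ z₂.re)) :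
    (∫ x : EuclideanSpace ℝ (Fin 3),
        Complex.exp (Complex.I * (sqrtB z₁ + sqrtB z₂) * (‖x‖ : ℂ))
          / (16 * (Real.pi : ℂ) ^ 2 * (‖x‖ : ℂ) ^ 2))
      = Complex.I / (4 * (Real.pi : ℂ) * (sqrtB z₁ + sqrtB z₂)) ∧
    (z₁ ≠ z₂ →
      (z₁ - z₂) * ∫ x : EuclideanSpace ℝ (Fin 3),
          (Complex.exp (Complex.I * sqrtB z₁ * (‖x‖ : ℂ)) / (4 * (Real.pi : ℂ) * (‖x‖ : ℂ)))
            * (Complex.exp (Complex.I * sqrtB z₂ * (‖x‖ : ℂ)) / (4 * (Real.pi : ℂ) * (‖x‖ : ℂ)))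
        = Complex.I * sqrtB z₁ / (4 * (Real.pi : ℂ))
          - Complex.I * sqrtB z₂ / (4 * (Real.pi : ℂ))) := by
  have him : 0 < (sqrtB z₁ + sqrtB z₂).im := by
    rw [Complex.add_im]
    exact add_pos (sqrtB_im_pos hz₁) (sqrtB_im_pos hz₂)
  have hsum : sqrtB z₁ + sqrtB z₂ ≠ 0 := by
    intro h
    simp [h] at him
  have hpi : (Real.pi : ℂ) ≠ 0 := by exact_mod_cast Real.pi_ne_zero
  have hint := integral_exp_I_mul_norm_div_norm_sq him
  refine ⟨hint, fun _ => ?_⟩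
  have hprod : ∀ x : EuclideanSpace ℝ (Fin 3),
      (Complex.exp (Complex.I * sqrtB z₁ * (‖x‖ : ℂ)) / (4 * (Real.pi : ℂ) * (‖x‖ : ℂ)))
          * (Complex.exp (Complex.I * sqrtB z₂ * (‖x‖ : ℂ)) / (4 * (Real.pi : ℂ) * (‖x‖ : ℂ)))
        = Complex.exp (Complex.I * (sqrtB z₁ + sqrtB z₂) * (‖x‖ : ℂ))
          / (16 * (Real.pi : ℂ) ^ 2 * (‖x‖ : ℂ) ^ 2) := by
    intro x
    rw [div_mul_div_comm, ← Complex.exp_add]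
    ring_nf
  have hdiff : z₁ - z₂ = (sqrtB z₁ - sqrtB z₂) * (sqrtB z₁ + sqrtB z₂) := by
    linear_combination sqrtB_sq z₂ - sqrtB_sq z₁
  simp_rw [hprod]
  rw [hint, hdiff]
  field_simp
end

section
/- For every κ > 0 and all points a, b ∈ ℝ³, the following integral identity holds: ∫_{ℝ³} e^{−κ|x−a|} e^{−κ|x−b|} / (|x−a| |x−b|) dx = (2π/κ) e^{−κ|a−b|}. Equivalently, the L²(ℝ³) inner product of the functions g_a(x) = e^{−κ|x−a|}/(4π|x−a|) and g_b(x) = e^{−κ|x−b|}/(4π|x−b|) equals e^{−κ|a−b|}/(8πκ). -/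
open MeasureTheory

open Set Filter Topology

theorem tendsto_intervalIntegral_exp_neg_sq_atTop :
    Tendsto (fun x : ℝ => ∫ t in (0 : ℝ)..x, Real.exp (-t ^ 2)) atTop (𝓝 (√Real.pi / 2)) := by
  have h := intervalIntegral_tendsto_integral_Ioi (μ := volume) (0 : ℝ)
    (integrable_exp_neg_mul_sq one_pos).integrableOn tendsto_id
  rw [integral_gaussian_Ioi] at h
  simpa using h

theorem tendsto_intervalIntegral_exp_neg_sq_atBot :
    Tendsto (fun x : ℝ => ∫ t in (0 : ℝ)..x, Real.exp (-t ^ 2)) atBot (𝓝 (-(√Real.pi / 2))) := by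
  have h := (tendsto_intervalIntegral_exp_neg_sq_atTop.comp tendsto_neg_atBot_atTop).neg
  refine h.congr fun x => ?_
  have := intervalIntegral.integral_comp_neg (a := 0) (b := x) fun t : ℝ => Real.exp (-t ^ 2)
  simp only [neg_sq, neg_zero] at this
  rw [Function.comp_apply, this, intervalIntegral.integral_symm, neg_neg]

theorem hasDerivAt_intervalIntegral_exp_neg_sq (x : ℝ) :
    HasDerivAt (fun x : ℝ => ∫ t in (0 : ℝ)..x, Real.exp (-t ^ 2)) (Real.exp (-x ^ 2)) x := by
  have hc : Continuous fun t : ℝ => Real.exp (-t ^ 2) := by fun_prop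
  exact intervalIntegral.integral_hasDerivAt_right (hc.intervalIntegrable _ _)
    (hc.stronglyMeasurableAtFilter _ _) hc.continuousAt

/-- A Glasser-type integral, evaluated through an explicit primitive in terms of the error
function. -/
theorem lintegral_exp_neg_div_sub_mul {k r p q : ℝ} (hk : 0 < k) (hr : 0 < r)
    (hp : 0 ≤ p) (hq : 0 ≤ q) :
    ∫⁻ t in Ioi (0 : ℝ), ENNReal.ofReal
        ((p / √t + q / √t ^ 3) * Real.exp (-r ^ 2 / t - k ^ 2 * t)) =
      ENNReal.ofReal (√Real.pi * (p / k + q / r) * Real.exp (-2 * r * k)) := by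
  set G : ℝ → ℝ := fun x => ∫ t in (0 : ℝ)..x, Real.exp (-t ^ 2) with hG
  set A := (p / k - q / r) * Real.exp (2 * r * k) with hA
  set B := (p / k + q / r) * Real.exp (-2 * r * k) with hB
  set F : ℝ → ℝ := fun t => A * G (k * √t + r / √t) + B * G (k * √t - r / √t) with hF
  set f : ℝ → ℝ := fun t => (p / √t + q / √t ^ 3) * Real.exp (-r ^ 2 / t - k ^ 2 * t) with hf
  have hderiv : ∀ t ∈ Ioi (0 : ℝ), HasDerivAt F (f t) t := by
    intro t ht
    have ht : 0 < t := ht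
    obtain ⟨s, hs, rfl⟩ : ∃ s : ℝ, 0 < s ∧ s ^ 2 = t := ⟨√t, by positivity, Real.sq_sqrt ht.le⟩
    have hss : √(s ^ 2) = s := Real.sqrt_sq hs.le
    have d1 : HasDerivAt (fun t : ℝ => √t) (1 / (2 * s)) (s ^ 2) := by
      simpa only [hss] using Real.hasDerivAt_sqrt ht.ne'
    have d2 : HasDerivAt (fun t : ℝ => r / √t) (-(r * (1 / (2 * s))) / s ^ 2) (s ^ 2) := by
      have := (hasDerivAt_const (s ^ 2) r).div d1 (by rw [hss]; exact hs.ne')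
      simp only [hss, zero_mul, zero_sub] at this
      exact this
    have dG1 := ((hasDerivAt_intervalIntegral_exp_neg_sq _).comp (s ^ 2)
      ((d1.const_mul k).add d2)).const_mul A
    have dG2 := ((hasDerivAt_intervalIntegral_exp_neg_sq _).comp (s ^ 2)
      ((d1.const_mul k).sub d2)).const_mul B
    refine (dG1.add dG2).congr_deriv ?_
    simp only [hf, hss, hA, hB, Pi.add_apply, Pi.sub_apply]
    have e1 : Real.exp (2 * r * k) * Real.exp (-(k * s + r / s) ^ 2)
        = Real.exp (-r ^ 2 / s ^ 2 - k ^ 2 * s ^ 2) := by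
      rw [← Real.exp_add]; congr 1; field
    have e2 : Real.exp (-2 * r * k) * Real.exp (-(k * s - r / s) ^ 2)
        = Real.exp (-r ^ 2 / s ^ 2 - k ^ 2 * s ^ 2) := by
      rw [← Real.exp_add]; congr 1; field
    calc _ = (p / k - q / r) * (Real.exp (2 * r * k) * Real.exp (-(k * s + r / s) ^ 2))
          * (k * (1 / (2 * s)) + -(r * (1 / (2 * s))) / s ^ 2) +
          (p / k + q / r) * (Real.exp (-2 * r * k) * Real.exp (-(k * s - r / s) ^ 2))
          * (k * (1 / (2 * s)) - -(r * (1 / (2 * s))) / s ^ 2) := by ring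
      _ = _ := by rw [e1, e2]; field
  have hfpos : ∀ t ∈ Ioi (0 : ℝ), 0 ≤ f t := fun t _ => by positivity
  have hsqrt0 : Tendsto (fun t : ℝ => √t) (𝓝[>] 0) (𝓝[>] 0) := by
    refine tendsto_nhdsWithin_iff.2 ⟨?_, ?_⟩
    · exact (Real.continuous_sqrt.tendsto' 0 0 Real.sqrt_zero).mono_left nhdsWithin_le_nhds
    · filter_upwards [self_mem_nhdsWithin] with t ht using Real.sqrt_pos.2 ht
  have hmul0 : Tendsto (fun t : ℝ => k * √t) (𝓝[>] 0) (𝓝 0) := by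
    simpa using (hsqrt0.mono_right nhdsWithin_le_nhds).const_mul k
  have hdiv0 : Tendsto (fun t : ℝ => r / √t) (𝓝[>] 0) atTop := by
    simpa only [div_eq_mul_inv, Function.comp_apply] using
      (tendsto_inv_nhdsGT_zero.comp hsqrt0).const_mul_atTop hr
  have hmulT : Tendsto (fun t : ℝ => k * √t) atTop atTop :=
    Real.tendsto_sqrt_atTop.const_mul_atTop hk
  have hdivT : Tendsto (fun t : ℝ => r / √t) atTop (𝓝 0) :=
    Real.tendsto_sqrt_atTop.const_div_atTop r
  have hF0 : Tendsto F (𝓝[>] 0) (𝓝 (A * (√Real.pi / 2) + B * (-(√Real.pi / 2)))) := by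
    refine ((tendsto_intervalIntegral_exp_neg_sq_atTop.comp (hmul0.add_atTop hdiv0)).const_mul
      A).add ((tendsto_intervalIntegral_exp_neg_sq_atBot.comp ?_).const_mul B)
    simpa only [sub_eq_add_neg, Function.comp_apply] using
      hmul0.add_atBot (tendsto_neg_atTop_atBot.comp hdiv0)
  have hFT : Tendsto F atTop (𝓝 (A * (√Real.pi / 2) + B * (√Real.pi / 2))) := by
    refine ((tendsto_intervalIntegral_exp_neg_sq_atTop.comp (hmulT.atTop_add hdivT)).const_mul
      A).add ((tendsto_intervalIntegral_exp_neg_sq_atTop.comp ?_).const_mul B)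
    simpa only [sub_eq_add_neg] using hmulT.atTop_add hdivT.neg
  set F' := Function.update F 0 (A * (√Real.pi / 2) + B * (-(√Real.pi / 2))) with hF'
  have hcont : ContinuousWithinAt F' (Ici 0) 0 := by
    rw [hF', continuousWithinAt_update_same, Ici_sdiff_left]
    exact hF0
  have hderiv' : ∀ t ∈ Ioi (0 : ℝ), HasDerivAt F' (f t) t := fun t ht =>
    (hderiv t ht).congr_of_eventuallyEq (by
      filter_upwards [isOpen_ne.mem_nhds (ne_of_gt ht : t ≠ 0)] with u hu
      exact Function.update_of_ne hu _ _)
  have hFT' : Tendsto F' atTop (𝓝 (A * (√Real.pi / 2) + B * (√Real.pi / 2))) :=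
    hFT.congr' (by
      filter_upwards [eventually_gt_atTop 0] with u hu
      exact (Function.update_of_ne hu.ne' _ _).symm)
  have hint := integrableOn_Ioi_deriv_of_nonneg hcont hderiv' hfpos hFT'
  have hval := integral_Ioi_of_hasDerivAt_of_nonneg hcont hderiv' hfpos hFT'
  rw [← ofReal_integral_eq_lintegral_ofReal hint
    (ae_restrict_of_forall_mem measurableSet_Ioi hfpos), hval]
  congr 1
  simp only [hF', Function.update_self, hB]
  ring

theorem lintegral_inv_sqrt_mul_exp {k r : ℝ} (hk : 0 < k) (hr : 0 ≤ r) :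
    ∫⁻ t in Ioi (0 : ℝ), ENNReal.ofReal (1 / √t * Real.exp (-r ^ 2 / t - k ^ 2 * t)) =
      ENNReal.ofReal (√Real.pi / k * Real.exp (-2 * r * k)) := by
  rcases hr.eq_or_lt with rfl | hr
  · have h := Real.integral_rpow_mul_exp_neg_mul_Ioi (a := 1 / 2) (r := k ^ 2)
      (by norm_num) (by positivity)
    have hpow : (1 / k ^ 2) ^ (1 / 2 : ℝ) = 1 / k := by
      rw [← Real.sqrt_eq_rpow, ← one_div_pow, Real.sqrt_sq (by positivity)]
    rw [Real.Gamma_one_half_eq, hpow] at h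
    have h' : ∫ t in Ioi (0 : ℝ), 1 / √t * Real.exp (-(0 : ℝ) ^ 2 / t - k ^ 2 * t) =
        1 / k * √Real.pi := by
      rw [← h]
      refine setIntegral_congr_fun measurableSet_Ioi fun t ht => ?_
      have ht : 0 < t := ht
      have : t ^ (1 / 2 - 1 : ℝ) = 1 / √t := by
        rw [Real.sqrt_eq_rpow, one_div (t ^ _), ← Real.rpow_neg ht.le]; norm_num
      simp only [this]
      simp
    rw [← ofReal_integral_eq_lintegral_ofReal, h']
    · congr 1; simp; ring
    · refine Integrable.of_integral_ne_zero ?_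
      rw [h']; positivity
    · exact Eventually.of_forall fun t => by positivity
  · simpa [div_eq_mul_inv] using lintegral_exp_neg_div_sub_mul hk hr zero_le_one le_rfl

/-- The Yukawa kernel as a superposition of Gaussians. -/
theorem lintegral_inv_sqrt_pow_three_mul_exp {k r : ℝ} (hk : 0 < k) (hr : 0 < r) :
    ∫⁻ t in Ioi (0 : ℝ), ENNReal.ofReal (1 / √t ^ 3 * Real.exp (-r ^ 2 / t - k ^ 2 * t)) =
      ENNReal.ofReal (√Real.pi / r * Real.exp (-2 * r * k)) := by
  simpa [div_eq_mul_inv] using lintegral_exp_neg_div_sub_mul hk hr le_rfl zero_le_one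

theorem lintegral_Ioi_Ioi_comp_add {h : ℝ → ENNReal} (hh : Measurable h) :
    ∫⁻ s in Ioi (0 : ℝ), ∫⁻ t in Ioi (0 : ℝ), h (s + t) =
      ∫⁻ u in Ioi (0 : ℝ), ENNReal.ofReal u * h u := by
  have h1 : ∀ s : ℝ, ∫⁻ t in Ioi (0 : ℝ), h (s + t) = ∫⁻ u, (Ioi s).indicator h u := by
    intro s
    rw [← lintegral_add_left_eq_self ((Ioi s).indicator h) s,
      ← lintegral_indicator measurableSet_Ioi]
    refine lintegral_congr fun t => ?_
    simp [indicator]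
  simp_rw [h1]
  rw [lintegral_lintegral_swap, ← lintegral_indicator measurableSet_Ioi]
  · refine lintegral_congr fun u => ?_
    have h2 : ∀ s : ℝ, (Ioi s).indicator h u = (Iio u).indicator (fun _ => h u) s := by
      intro s; simp [indicator]
    simp_rw [h2]
    rw [lintegral_indicator measurableSet_Iio, setLIntegral_const,
      Measure.restrict_apply measurableSet_Iio, Iio_inter_Ioi, Real.volume_Ioo, sub_zero, mul_comm]
    by_cases hu : 0 < u
    · simp [hu]
    · simp [hu, ENNReal.ofReal_of_nonpos (not_lt.1 hu)]
  · have : (Function.uncurry fun s u : ℝ => (Ioi s).indicator h u) =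
        {z : ℝ × ℝ | z.1 < z.2}.indicator fun z => h z.2 := by
      ext z; simp [Function.uncurry, indicator]
    rw [this]
    exact ((hh.comp measurable_snd).indicator
      (measurableSet_lt measurable_fst measurable_snd)).aemeasurable

theorem lintegral_exp_neg_mul_sq_norm_sub_mul {α β : ℝ} (hα : 0 < α) (hβ : 0 < β)
    (a b : EuclideanSpace ℝ (Fin 3)) :
    ∫⁻ x : EuclideanSpace ℝ (Fin 3),
        ENNReal.ofReal (Real.exp (-α * ‖x - a‖ ^ 2 - β * ‖x - b‖ ^ 2)) =
      ENNReal.ofReal (√(Real.pi / (α + β)) ^ 3 *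
        Real.exp (-(α * β / (α + β)) * ‖a - b‖ ^ 2)) := by
  have hαβ : 0 < α + β := add_pos hα hβ
  set c : EuclideanSpace ℝ (Fin 3) := (β / (α + β)) • (a - b) with hc
  have key : ∀ y : EuclideanSpace ℝ (Fin 3),
      Real.exp (-α * ‖y + (a - c) - a‖ ^ 2 - β * ‖y + (a - c) - b‖ ^ 2) =
        Real.exp (-(α + β) * ‖y‖ ^ 2) * Real.exp (-(α * β / (α + β)) * ‖a - b‖ ^ 2) := by
    intro y
    have e1 : y + (a - c) - a = y - (β / (α + β)) • (a - b) := by rw [hc]; abel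
    have e2 : y + (a - c) - b = y + (α / (α + β)) • (a - b) := by
      have : α / (α + β) = 1 - β / (α + β) := by field
      rw [hc, this, sub_smul, one_smul]; abel
    rw [e1, e2, norm_sub_sq_real, norm_add_sq_real, norm_smul, norm_smul, inner_smul_right,
      inner_smul_right, ← Real.exp_add, Real.norm_of_nonneg (by positivity),
      Real.norm_of_nonneg (by positivity)]
    congr 1
    field
  have hI : ∫ y : EuclideanSpace ℝ (Fin 3), Real.exp (-(α + β) * ‖y‖ ^ 2) =
      √(Real.pi / (α + β)) ^ 3 := by
    rw [GaussianFourier.integral_rexp_neg_mul_sq_norm hαβ, Real.sqrt_eq_rpow,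
      ← Real.rpow_mul_natCast (by positivity)]
    simp; norm_num
  rw [← lintegral_add_right_eq_self _ (a - c)]
  simp_rw [key]
  rw [← ofReal_integral_eq_lintegral_ofReal, integral_mul_const, hI]
  · refine Integrable.mul_const (Integrable.of_integral_ne_zero ?_) _
    rw [hI]; positivity
  · exact Eventually.of_forall fun y => by positivity

/-- The Gaussian density whose integral over `t > 0` is the Yukawa kernel `exp (-κ * r) / r`. -/
noncomputable def yukawaDensity (κ t r : ℝ) : ℝ :=
  1 / √Real.pi * (1 / √t ^ 3 * Real.exp (-r ^ 2 / t - (κ / 2) ^ 2 * t))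

theorem yukawaDensity_nonneg (κ t r : ℝ) : 0 ≤ yukawaDensity κ t r := by
  unfold yukawaDensity; positivity

theorem measurable_yukawaDensity {β : Type*} [MeasurableSpace β] (κ : ℝ) {f g : β → ℝ}
    (hf : Measurable f) (hg : Measurable g) :
    Measurable fun y => ENNReal.ofReal (yukawaDensity κ (f y) (g y)) := by
  unfold yukawaDensity; fun_prop

theorem lintegral_yukawaDensity {κ r : ℝ} (hκ : 0 < κ) (hr : 0 < r) :
    ∫⁻ t in Ioi (0 : ℝ), ENNReal.ofReal (yukawaDensity κ t r) =
      ENNReal.ofReal (Real.exp (-κ * r) / r) := by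
  have hpi : √Real.pi ≠ 0 := by positivity
  simp_rw [yukawaDensity, ENNReal.ofReal_mul (show 0 ≤ 1 / √Real.pi by positivity)]
  rw [lintegral_const_mul _ (by fun_prop),
    lintegral_inv_sqrt_pow_three_mul_exp (half_pos hκ) hr, ← ENNReal.ofReal_mul (by positivity)]
  congr 1
  rw [show -2 * r * (κ / 2) = -κ * r by ring]
  field

theorem lintegral_yukawaDensity_mul (κ : ℝ) {s t : ℝ} (hs : 0 < s) (ht : 0 < t)
    (a b : EuclideanSpace ℝ (Fin 3)) :
    ∫⁻ x : EuclideanSpace ℝ (Fin 3), ENNReal.ofReal (yukawaDensity κ s ‖x - a‖) *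
        ENNReal.ofReal (yukawaDensity κ t ‖x - b‖) =
      ENNReal.ofReal (Real.pi * yukawaDensity κ (s + t) ‖a - b‖) := by
  have hpi := Real.pi_pos
  set C := 1 / Real.pi * (1 / √s ^ 3) * (1 / √t ^ 3) * Real.exp (-(κ / 2) ^ 2 * (s + t))
    with hC
  have hCpos : 0 ≤ C := by positivity
  have e : ∀ x : EuclideanSpace ℝ (Fin 3), ENNReal.ofReal (yukawaDensity κ s ‖x - a‖) *
      ENNReal.ofReal (yukawaDensity κ t ‖x - b‖) = ENNReal.ofReal C *
      ENNReal.ofReal (Real.exp (-s⁻¹ * ‖x - a‖ ^ 2 - t⁻¹ * ‖x - b‖ ^ 2)) := by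
    intro x
    rw [← ENNReal.ofReal_mul (yukawaDensity_nonneg ..), ← ENNReal.ofReal_mul hCpos]
    congr 1
    simp only [yukawaDensity]
    have : Real.exp (-‖x - a‖ ^ 2 / s - (κ / 2) ^ 2 * s) *
        Real.exp (-‖x - b‖ ^ 2 / t - (κ / 2) ^ 2 * t) =
        Real.exp (-(κ / 2) ^ 2 * (s + t)) *
          Real.exp (-s⁻¹ * ‖x - a‖ ^ 2 - t⁻¹ * ‖x - b‖ ^ 2) := by
      rw [← Real.exp_add, ← Real.exp_add]; congr 1; ring
    have hp : 1 / √Real.pi * (1 / √Real.pi) = 1 / Real.pi := by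
      rw [div_mul_div_comm, Real.mul_self_sqrt hpi.le, one_mul]
    rw [hC, ← hp]
    linear_combination (1 / √Real.pi * (1 / √Real.pi) * (1 / √s ^ 3) * (1 / √t ^ 3)) * this
  simp_rw [e]
  rw [lintegral_const_mul _ (by fun_prop),
    lintegral_exp_neg_mul_sq_norm_sub_mul (inv_pos.2 hs) (inv_pos.2 ht),
    ← ENNReal.ofReal_mul hCpos]
  congr 1
  have q : √(Real.pi / (s⁻¹ + t⁻¹)) = √Real.pi * √s * √t / √(s + t) := by
    rw [← Real.sqrt_mul hpi.le, ← Real.sqrt_mul (by positivity), ← Real.sqrt_div (by positivity)]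
    congr 1; field
  have E : Real.exp (-(κ / 2) ^ 2 * (s + t)) *
      Real.exp (-(s⁻¹ * t⁻¹ / (s⁻¹ + t⁻¹)) * ‖a - b‖ ^ 2) =
      Real.exp (-‖a - b‖ ^ 2 / (s + t) - (κ / 2) ^ 2 * (s + t)) := by
    rw [← Real.exp_add]; congr 1; field
  have hst : √(s + t) ≠ 0 := by positivity
  have hs' : √s ≠ 0 := by positivity
  have ht' : √t ≠ 0 := by positivity
  have q3 : (√Real.pi * √s * √t / √(s + t)) ^ 3 =
      Real.pi * √Real.pi * √s ^ 3 * √t ^ 3 / √(s + t) ^ 3 := by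
    rw [div_pow, mul_pow, mul_pow, pow_succ √Real.pi, Real.sq_sqrt hpi.le]
  have hdiv : Real.pi * (1 / √Real.pi) = √Real.pi := by
    rw [mul_one_div, Real.div_sqrt]
  simp only [yukawaDensity]
  rw [hC, q, q3, ← E, ← mul_assoc Real.pi, hdiv]
  field

theorem lintegral_yukawa_kernel_mul {κ : ℝ} (hκ : 0 < κ) (a b : EuclideanSpace ℝ (Fin 3)) :
    ∫⁻ x : EuclideanSpace ℝ (Fin 3), ENNReal.ofReal
        (Real.exp (-κ * ‖x - a‖) * Real.exp (-κ * ‖x - b‖) / (‖x - a‖ * ‖x - b‖)) =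
      ENNReal.ofReal ((2 * Real.pi / κ) * Real.exp (-κ * ‖a - b‖)) := by
  have hpi := Real.pi_pos
  have hH' : ∀ u ∈ Ioi (0 : ℝ),
      ENNReal.ofReal u * ENNReal.ofReal (Real.pi * yukawaDensity κ u ‖a - b‖) =
        ENNReal.ofReal (√Real.pi) * ENNReal.ofReal (1 / √u *
          Real.exp (-‖a - b‖ ^ 2 / u - (κ / 2) ^ 2 * u)) := by
    intro u hu
    have hu : 0 < u := hu
    rw [← ENNReal.ofReal_mul hu.le, ← ENNReal.ofReal_mul (Real.sqrt_nonneg _)]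
    congr 1
    have hpi' : √Real.pi ≠ 0 := by positivity
    have hu' : √u ≠ 0 := by positivity
    have hp : Real.pi = √Real.pi * √Real.pi := (Real.mul_self_sqrt hpi.le).symm
    have : √u ^ 3 = u * √u := by rw [pow_succ, Real.sq_sqrt hu.le]
    simp only [yukawaDensity]
    rw [this]
    nth_rewrite 1 [hp]
    field
  calc _ = ∫⁻ x : EuclideanSpace ℝ (Fin 3), ∫⁻ s in Ioi (0 : ℝ), ∫⁻ t in Ioi (0 : ℝ),
        ENNReal.ofReal (yukawaDensity κ s ‖x - a‖) *
          ENNReal.ofReal (yukawaDensity κ t ‖x - b‖) := by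
        refine lintegral_congr_ae ?_
        filter_upwards [compl_mem_ae_iff.2 (measure_singleton a),
          compl_mem_ae_iff.2 (measure_singleton b)] with x hxa hxb
        have ha : 0 < ‖x - a‖ := norm_pos_iff.2 (sub_ne_zero.2 hxa)
        have hb : 0 < ‖x - b‖ := norm_pos_iff.2 (sub_ne_zero.2 hxb)
        have hm (r : ℝ) : Measurable fun t => ENNReal.ofReal (yukawaDensity κ t r) :=
          measurable_yukawaDensity κ measurable_id measurable_const
        rw [lintegral_lintegral_mul (hm _).aemeasurable (hm _).aemeasurable,
          lintegral_yukawaDensity hκ ha, lintegral_yukawaDensity hκ hb,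
          ← ENNReal.ofReal_mul (by positivity), div_mul_div_comm]
    _ = ∫⁻ s in Ioi (0 : ℝ), ∫⁻ x : EuclideanSpace ℝ (Fin 3), ∫⁻ t in Ioi (0 : ℝ),
        ENNReal.ofReal (yukawaDensity κ s ‖x - a‖) *
          ENNReal.ofReal (yukawaDensity κ t ‖x - b‖) := by
        refine lintegral_lintegral_swap (Measurable.aemeasurable ?_)
        refine Measurable.lintegral_prod_right'
          (f := fun z : (EuclideanSpace ℝ (Fin 3) × ℝ) × ℝ =>
            ENNReal.ofReal (yukawaDensity κ z.1.2 ‖z.1.1 - a‖) *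
              ENNReal.ofReal (yukawaDensity κ z.2 ‖z.1.1 - b‖)) ?_
        exact (measurable_yukawaDensity κ (by fun_prop) (by fun_prop)).mul
          (measurable_yukawaDensity κ (by fun_prop) (by fun_prop))
    _ = ∫⁻ s in Ioi (0 : ℝ), ∫⁻ t in Ioi (0 : ℝ), ∫⁻ x : EuclideanSpace ℝ (Fin 3),
        ENNReal.ofReal (yukawaDensity κ s ‖x - a‖) *
          ENNReal.ofReal (yukawaDensity κ t ‖x - b‖) := by
        refine lintegral_congr fun s => lintegral_lintegral_swap (Measurable.aemeasurable ?_)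
        exact (measurable_yukawaDensity κ (f := fun _ : EuclideanSpace ℝ (Fin 3) × ℝ => s)
          (by fun_prop) (by fun_prop)).mul
          (measurable_yukawaDensity κ (by fun_prop) (by fun_prop))
    _ = ∫⁻ s in Ioi (0 : ℝ), ∫⁻ t in Ioi (0 : ℝ),
        ENNReal.ofReal (Real.pi * yukawaDensity κ (s + t) ‖a - b‖) :=
        setLIntegral_congr_fun measurableSet_Ioi fun s hs =>
          setLIntegral_congr_fun measurableSet_Ioi fun t ht =>
            lintegral_yukawaDensity_mul κ hs ht a b
    _ = ∫⁻ u in Ioi (0 : ℝ), ENNReal.ofReal u *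
        ENNReal.ofReal (Real.pi * yukawaDensity κ u ‖a - b‖) :=
        lintegral_Ioi_Ioi_comp_add
          (h := fun u => ENNReal.ofReal (Real.pi * yukawaDensity κ u ‖a - b‖))
          (by unfold yukawaDensity; fun_prop)
    _ = _ := by
        rw [setLIntegral_congr_fun measurableSet_Ioi hH', lintegral_const_mul _ (by fun_prop),
          lintegral_inv_sqrt_mul_exp (half_pos hκ) (norm_nonneg _),
          ← ENNReal.ofReal_mul (by positivity)]
        congr 1
        rw [show -2 * ‖a - b‖ * (κ / 2) = -κ * ‖a - b‖ by ring, ← mul_assoc, mul_div_assoc',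
          Real.mul_self_sqrt hpi.le]
        field

theorem yukawa_kernel_inner_product (κ : ℝ) (hκ : 0 < κ)
    (a b : EuclideanSpace ℝ (Fin 3)) :
    (∫ x : EuclideanSpace ℝ (Fin 3),
        Real.exp (-κ * ‖x - a‖) * Real.exp (-κ * ‖x - b‖) / (‖x - a‖ * ‖x - b‖))
      = (2 * Real.pi / κ) * Real.exp (-κ * ‖a - b‖) ∧
    (∫ x : EuclideanSpace ℝ (Fin 3),
        (Real.exp (-κ * ‖x - a‖) / (4 * Real.pi * ‖x - a‖))
          * (Real.exp (-κ * ‖x - b‖) / (4 * Real.pi * ‖x - b‖)))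
      = Real.exp (-κ * ‖a - b‖) / (8 * Real.pi * κ) := by
  have h1 : (∫ x : EuclideanSpace ℝ (Fin 3),
        Real.exp (-κ * ‖x - a‖) * Real.exp (-κ * ‖x - b‖) / (‖x - a‖ * ‖x - b‖))
      = (2 * Real.pi / κ) * Real.exp (-κ * ‖a - b‖) := by
    rw [integral_eq_lintegral_of_nonneg_ae (Eventually.of_forall fun x => by positivity)
      (Measurable.aestronglyMeasurable (by fun_prop)), lintegral_yukawa_kernel_mul hκ,
      ENNReal.toReal_ofReal (by positivity)]
  refine ⟨h1, ?_⟩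
  have h2 : ∀ x : EuclideanSpace ℝ (Fin 3),
      (Real.exp (-κ * ‖x - a‖) / (4 * Real.pi * ‖x - a‖))
          * (Real.exp (-κ * ‖x - b‖) / (4 * Real.pi * ‖x - b‖)) =
        1 / (16 * Real.pi ^ 2) *
          (Real.exp (-κ * ‖x - a‖) * Real.exp (-κ * ‖x - b‖) / (‖x - a‖ * ‖x - b‖)) :=
    fun x => by ring
  simp_rw [h2]
  rw [integral_const_mul, h1]
  field
end

section
/- Let l > 0 and let u : [0, l] → ℂ be continuously differentiable with u(0) = u(l) = 0. Then for every x ∈ (0, l), lim_{ρ → 0⁺} [ ∫₀^l u(s)/√((x−s)² + ρ²) ds − u(x)·ln(1/ρ²) ] = 2·ln 2·u(x) − ∫₀^l sgn(s − x)·ln|s − x|·u′(s) ds, where sgn(t) = t/|t| for t ≠ 0. Equivalently, ∫₀^l u(s)/√((x−s)² + ρ²) ds = u(x)·ln(1/ρ²) + 2·ln 2·u(x) − ∫₀^l sgn(s − x)·ln|s − x|·u′(s) ds + o(1) as ρ → 0⁺. -/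
open MeasureTheory Complex Filter

namespace Real

theorem measurable_sign : Measurable Real.sign :=
  Measurable.ite measurableSet_Iio measurable_const
    (Measurable.ite measurableSet_Ioi measurable_const measurable_const)

theorem abs_sign_le_one (t : ℝ) : |Real.sign t| ≤ 1 := by
  rcases Real.sign_apply_eq t with h | h | h <;> simp [h]

/-- The odd function `t ↦ arsinh (t / ρ)` in terms of the logarithm. -/
theorem arsinh_div_eq_sign_mul_log {t ρ : ℝ} (ht : t ≠ 0) (hρ : 0 < ρ) :
    Real.arsinh (t / ρ) =
      Real.sign t * (Real.log (|t| + Real.sqrt (t ^ 2 + ρ ^ 2)) - Real.log ρ) := by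
  have pos_case : ∀ {r : ℝ}, 0 < r →
      Real.arsinh (r / ρ) = Real.log (r + Real.sqrt (r ^ 2 + ρ ^ 2)) - Real.log ρ := by
    intro r hr
    have hsqrt : Real.sqrt (1 + (r / ρ) ^ 2) = Real.sqrt (r ^ 2 + ρ ^ 2) / ρ := by
      rw [eq_div_iff hρ.ne', ← Real.sqrt_sq hρ.le, ← Real.sqrt_mul (by positivity),
        Real.sqrt_sq hρ.le]
      congr 1
      field_simp
      ring
    rw [Real.arsinh, hsqrt, ← add_div, Real.log_div (by positivity) hρ.ne']
  rcases ht.lt_or_gt with h | h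
  · rw [Real.sign_of_neg h, abs_of_neg h, ← neg_sq t, ← pos_case (neg_pos.2 h), neg_div,
      Real.arsinh_neg]
    ring
  · rw [Real.sign_of_pos h, abs_of_pos h, ← pos_case h, one_mul]

theorem hasDerivAt_arsinh_sub_div (x s : ℝ) {ρ : ℝ} (hρ : 0 < ρ) :
    HasDerivAt (fun s => Real.arsinh ((s - x) / ρ)) (Real.sqrt ((x - s) ^ 2 + ρ ^ 2))⁻¹ s := by
  have h := (((hasDerivAt_id s).sub_const x).div_const ρ).arsinh
  refine h.congr_deriv ?_
  have hsqrt : Real.sqrt ((x - s) ^ 2 + ρ ^ 2) = ρ * Real.sqrt (1 + ((s - x) / ρ) ^ 2) := by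
    rw [← Real.sqrt_sq hρ.le, ← Real.sqrt_mul (sq_nonneg _), Real.sqrt_sq hρ.le]
    congr 1
    field_simp
    ring
  simp [hsqrt, mul_comm]

/-- The primitive of `1 / √(t ^ 2 + ρ ^ 2)`, renormalized so that it converges as `ρ → 0⁺`. -/
noncomputable def renormalizedArsinh (ρ t : ℝ) : ℝ :=
  Real.arsinh (t / ρ) + Real.sign t * Real.log ρ

theorem renormalizedArsinh_eq {t ρ : ℝ} (ht : t ≠ 0) (hρ : 0 < ρ) :
    renormalizedArsinh ρ t = Real.sign t * Real.log (|t| + Real.sqrt (t ^ 2 + ρ ^ 2)) := by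
  rw [renormalizedArsinh, arsinh_div_eq_sign_mul_log ht hρ]
  ring

theorem measurable_renormalizedArsinh (ρ : ℝ) : Measurable (renormalizedArsinh ρ) :=
  ((Real.continuous_arsinh.comp (continuous_id.div_const ρ)).measurable).add
    (measurable_sign.mul_const _)

theorem abs_renormalizedArsinh_le {t ρ : ℝ} (ht : t ≠ 0) (hρ : 0 < ρ) (hρ1 : ρ ≤ 1) :
    |renormalizedArsinh ρ t| ≤ |Real.log t| + (2 * |t| + 1) := by
  have ht' : 0 < |t| := abs_pos.2 ht
  have hsqrt : Real.sqrt (t ^ 2 + ρ ^ 2) ≤ |t| + 1 := by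
    rw [Real.sqrt_le_left (by positivity), ← sq_abs t]
    nlinarith
  have hsqrt0 := Real.sqrt_nonneg (t ^ 2 + ρ ^ 2)
  rw [renormalizedArsinh_eq ht hρ, abs_mul]
  refine (mul_le_of_le_one_left (abs_nonneg _) (abs_sign_le_one t)).trans ?_
  have hlow : Real.log t ≤ Real.log (|t| + Real.sqrt (t ^ 2 + ρ ^ 2)) := by
    rw [← Real.log_abs t]
    exact Real.log_le_log ht' (by linarith)
  have hup := Real.log_le_sub_one_of_pos (x := |t| + Real.sqrt (t ^ 2 + ρ ^ 2)) (by positivity)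
  rw [abs_le]
  constructor
  · linarith [neg_abs_le (Real.log t)]
  · linarith [abs_nonneg (Real.log t)]

theorem tendsto_renormalizedArsinh {t : ℝ} (ht : t ≠ 0) :
    Tendsto (fun ρ => renormalizedArsinh ρ t) (nhdsWithin 0 (Set.Ioi 0))
      (nhds (Real.sign t * (Real.log 2 + Real.log |t|))) := by
  have ht' : 0 < |t| := abs_pos.2 ht
  have hcont : ContinuousAt
      (fun ρ : ℝ => Real.sign t * Real.log (|t| + Real.sqrt (t ^ 2 + ρ ^ 2))) 0 := by
    refine continuousAt_const.mul (ContinuousAt.log (by fun_prop) ?_)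
    positivity
  have hval : Real.sign t * Real.log (|t| + Real.sqrt (t ^ 2 + 0 ^ 2)) =
      Real.sign t * (Real.log 2 + Real.log |t|) := by
    rw [← Real.log_mul two_ne_zero ht'.ne', two_mul]
    simp [Real.sqrt_sq_eq_abs]
  have h := hcont.tendsto.mono_left (nhdsWithin_le_nhds (s := Set.Ioi 0))
  rw [hval] at h
  refine h.congr' ?_
  filter_upwards [self_mem_nhdsWithin] with ρ hρ
  exact (renormalizedArsinh_eq ht hρ).symm

theorem intervalIntegrable_log_sub (a b x : ℝ) :
    IntervalIntegrable (fun s => Real.log (s - x)) volume a b := by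
  simpa using (intervalIntegral.intervalIntegrable_log' (a := a - x) (b := b - x)).comp_sub_right x

end Real

theorem IntervalIntegrable.ofReal_mul_of_abs_le {a b c : ℝ} {f : ℝ → ℝ} {g : ℝ → ℂ}
    (hg : IntervalIntegrable g volume a b) (hf : Measurable f) (hfc : ∀ s, |f s| ≤ c) :
    IntervalIntegrable (fun s => (f s : ℂ) * g s) volume a b := by
  rw [intervalIntegrable_iff] at hg ⊢
  refine Integrable.bdd_mul (c := c) hg ?_ ?_
  · exact (Complex.measurable_ofReal.comp hf).aestronglyMeasurable
  · exact Eventually.of_forall fun s => by simpa using hfc s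

section

variable {l : ℝ} {u u' : ℝ → ℂ}

theorem integral_sign_sub_mul_deriv
    (hderiv : ∀ s ∈ Set.Icc (0 : ℝ) l, HasDerivWithinAt u (u' s) (Set.Icc (0 : ℝ) l) s)
    (hcont : ContinuousOn u' (Set.Icc (0 : ℝ) l))
    (hu0 : u 0 = 0) (hul : u l = 0) {x : ℝ} (hx : x ∈ Set.Ioo (0 : ℝ) l) :
    ∫ s in (0 : ℝ)..l, ((Real.sign (s - x) : ℝ) : ℂ) * u' s = -2 * u x := by
  have hftc : ∀ {a b : ℝ}, a ≤ b → Set.Icc a b ⊆ Set.Icc 0 l → ∫ s in a..b, u' s = u b - u a := by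
    intro a b hab hsub
    refine intervalIntegral.integral_eq_sub_of_hasDerivAt_of_le hab
      (fun s hs => (hderiv s (hsub hs)).continuousWithinAt.mono hsub) (fun s hs => ?_)
      ((hcont.mono hsub).intervalIntegrable_of_Icc hab)
    exact (hderiv s (hsub (Set.Ioo_subset_Icc_self hs))).hasDerivAt
      (mem_of_superset (Icc_mem_nhds hs.1 hs.2) hsub)
  have hint : ∀ {a b : ℝ}, a ≤ b → Set.Icc a b ⊆ Set.Icc 0 l →
      IntervalIntegrable (fun s => ((Real.sign (s - x) : ℝ) : ℂ) * u' s) volume a b :=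
    fun hab hsub => ((hcont.mono hsub).intervalIntegrable_of_Icc hab).ofReal_mul_of_abs_le
      (Real.measurable_sign.comp (measurable_id.sub_const x)) fun s => Real.abs_sign_le_one _
  have hleft : Set.Icc 0 x ⊆ Set.Icc 0 l := Set.Icc_subset_Icc_right hx.2.le
  have hright : Set.Icc x l ⊆ Set.Icc 0 l := Set.Icc_subset_Icc_left hx.1.le
  rw [← intervalIntegral.integral_add_adjacent_intervals (hint hx.1.le hleft)
      (hint hx.2.le hright),
    intervalIntegral.integral_congr_Ioo_of_le (g := fun s => -u' s) hx.1.le fun s hs => by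
      simp [Real.sign_of_neg (sub_neg.2 hs.2)],
    intervalIntegral.integral_congr_Ioo_of_le (g := u') hx.2.le fun s hs => by
      simp [Real.sign_of_pos (sub_pos.2 hs.1)],
    intervalIntegral.integral_neg, hftc hx.1.le hleft, hftc hx.2.le hright, hu0, hul]
  ring

theorem integral_div_sqrt_sub_eq (hl : 0 < l)
    (hderiv : ∀ s ∈ Set.Icc (0 : ℝ) l, HasDerivWithinAt u (u' s) (Set.Icc (0 : ℝ) l) s)
    (hcont : ContinuousOn u' (Set.Icc (0 : ℝ) l))
    (hu0 : u 0 = 0) (hul : u l = 0) {x ρ : ℝ} (hx : x ∈ Set.Ioo (0 : ℝ) l) (hρ : 0 < ρ) :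
    (∫ s in (0 : ℝ)..l, u s / ((Real.sqrt ((x - s) ^ 2 + ρ ^ 2) : ℝ) : ℂ))
        - u x * ((Real.log (1 / ρ ^ 2) : ℝ) : ℂ) =
      -∫ s in (0 : ℝ)..l, ((Real.renormalizedArsinh ρ (s - x) : ℝ) : ℂ) * u' s := by
  have hu' : IntervalIntegrable u' volume 0 l := hcont.intervalIntegrable_of_Icc hl.le
  have hF : Continuous fun s : ℝ => ((Real.arsinh ((s - x) / ρ) : ℝ) : ℂ) :=
    Complex.continuous_ofReal.comp
      (Real.continuous_arsinh.comp ((continuous_id.sub continuous_const).div_const ρ))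
  have hkernel : Continuous fun s : ℝ => (((Real.sqrt ((x - s) ^ 2 + ρ ^ 2))⁻¹ : ℝ) : ℂ) := by
    refine Complex.continuous_ofReal.comp (Continuous.inv₀ (by fun_prop) fun s => ?_)
    positivity
  have hparts : ∫ s in (0 : ℝ)..l, u s / ((Real.sqrt ((x - s) ^ 2 + ρ ^ 2) : ℝ) : ℂ) =
      -∫ s in (0 : ℝ)..l, ((Real.arsinh ((s - x) / ρ) : ℝ) : ℂ) * u' s := by
    have h := intervalIntegral.integral_mul_deriv_eq_deriv_mul_of_hasDerivWithinAt
      (a := 0) (b := l) (u := u) (u' := u')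
      (v := fun s : ℝ => ((Real.arsinh ((s - x) / ρ) : ℝ) : ℂ))
      (v' := fun s : ℝ => (((Real.sqrt ((x - s) ^ 2 + ρ ^ 2))⁻¹ : ℝ) : ℂ))
      (by rwa [Set.uIcc_of_le hl.le])
      (fun s _ => (Real.hasDerivAt_arsinh_sub_div x s hρ).ofReal_comp.hasDerivWithinAt)
      hu' (hkernel.intervalIntegrable 0 l)
    rw [hu0, hul] at h
    simpa [div_eq_mul_inv, mul_comm] using h
  have hsign : IntervalIntegrable (fun s => ((Real.sign (s - x) : ℝ) : ℂ) * u' s) volume 0 l :=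
    hu'.ofReal_mul_of_abs_le (Real.measurable_sign.comp (measurable_id.sub_const x))
      fun s => Real.abs_sign_le_one _
  have hsplit : ∀ s, ((Real.renormalizedArsinh ρ (s - x) : ℝ) : ℂ) * u' s =
      ((Real.arsinh ((s - x) / ρ) : ℝ) : ℂ) * u' s +
        ((Real.log ρ : ℝ) : ℂ) * (((Real.sign (s - x) : ℝ) : ℂ) * u' s) := by
    intro s
    rw [Real.renormalizedArsinh]
    push_cast
    ring
  simp_rw [hsplit]
  rw [intervalIntegral.integral_add (hu'.continuousOn_mul hF.continuousOn) (hsign.const_mul _),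
    intervalIntegral.integral_const_mul, integral_sign_sub_mul_deriv hderiv hcont hu0 hul hx,
    hparts, one_div, Real.log_inv, Real.log_pow]
  push_cast
  ring

end

theorem log_singularity_asymptotics
    (l : ℝ) (hl : 0 < l) (u u' : ℝ → ℂ)
    (hderiv : ∀ s ∈ Set.Icc (0 : ℝ) l, HasDerivWithinAt u (u' s) (Set.Icc (0 : ℝ) l) s)
    (hcont : ContinuousOn u' (Set.Icc (0 : ℝ) l))
    (hu0 : u 0 = 0) (hul : u l = 0) :
    ∀ x ∈ Set.Ioo (0 : ℝ) l,
      Tendsto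
        (fun ρ : ℝ =>
          (∫ s in (0 : ℝ)..l, u s / ((Real.sqrt ((x - s) ^ 2 + ρ ^ 2) : ℝ) : ℂ))
            - u x * ((Real.log (1 / ρ ^ 2) : ℝ) : ℂ))
        (nhdsWithin 0 (Set.Ioi 0))
        (nhds (2 * ((Real.log 2 : ℝ) : ℂ) * u x
          - ∫ s in (0 : ℝ)..l, ((Real.sign (s - x) : ℝ) : ℂ)
              * ((Real.log |s - x| : ℝ) : ℂ) * u' s)) := by
  intro x hx
  have hu' : IntervalIntegrable u' volume 0 l := hcont.intervalIntegrable_of_Icc hl.le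
  have hcont' : ContinuousOn u' (Set.uIcc 0 l) := by rwa [Set.uIcc_of_le hl.le]
  have hmeas_sub : Measurable fun s : ℝ => s - x := measurable_id.sub_const x
  have hsign : IntervalIntegrable (fun s => ((Real.sign (s - x) : ℝ) : ℂ) * u' s) volume 0 l :=
    hu'.ofReal_mul_of_abs_le (Real.measurable_sign.comp hmeas_sub)
      fun s => Real.abs_sign_le_one _
  have hlog : IntervalIntegrable (fun s => ((Real.sign (s - x) : ℝ) : ℂ)
      * ((Real.log |s - x| : ℝ) : ℂ) * u' s) volume 0 l := by
    have h : IntervalIntegrable (fun s => ((Real.log |s - x| : ℝ) : ℂ)) volume 0 l := by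
      simp_rw [Real.log_abs]
      have hreal := Real.intervalIntegrable_log_sub 0 l x
      exact ⟨hreal.1.ofReal, hreal.2.ofReal⟩
    exact (h.ofReal_mul_of_abs_le (Real.measurable_sign.comp hmeas_sub)
      fun s => Real.abs_sign_le_one _).mul_continuousOn hcont'
  have hlimit : 2 * ((Real.log 2 : ℝ) : ℂ) * u x
      - ∫ s in (0 : ℝ)..l, ((Real.sign (s - x) : ℝ) : ℂ) * ((Real.log |s - x| : ℝ) : ℂ) * u' s =
      -∫ s in (0 : ℝ)..l,
        ((Real.sign (s - x) * (Real.log 2 + Real.log |s - x|) : ℝ) : ℂ) * u' s := by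
    have hsplit : ∀ s,
        ((Real.sign (s - x) * (Real.log 2 + Real.log |s - x|) : ℝ) : ℂ) * u' s =
        ((Real.log 2 : ℝ) : ℂ) * (((Real.sign (s - x) : ℝ) : ℂ) * u' s) +
          ((Real.sign (s - x) : ℝ) : ℂ) * ((Real.log |s - x| : ℝ) : ℂ) * u' s := by
      intro s
      push_cast
      ring
    simp_rw [hsplit]
    rw [intervalIntegral.integral_add (hsign.const_mul _) hlog,
      intervalIntegral.integral_const_mul, integral_sign_sub_mul_deriv hderiv hcont hu0 hul hx]
    ring
  have hne : ∀ᵐ s : ℝ, s - x ≠ 0 := by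
    filter_upwards [Measure.ae_ne volume x] with s hs using sub_ne_zero.2 hs
  have hbound : IntervalIntegrable
      (fun s => (|Real.log (s - x)| + (2 * |s - x| + 1)) * ‖u' s‖) volume 0 l :=
    ((Real.intervalIntegrable_log_sub 0 l x).abs.add
      (Continuous.intervalIntegrable (by fun_prop) 0 l)).mul_continuousOn hcont'.norm
  rw [hlimit]
  refine Tendsto.congr' ?_ (intervalIntegral.tendsto_integral_filter_of_dominated_convergence
    (F := fun ρ s => ((Real.renormalizedArsinh ρ (s - x) : ℝ) : ℂ) * u' s)
    (fun s => (|Real.log (s - x)| + (2 * |s - x| + 1)) * ‖u' s‖) ?_ ?_ hbound ?_).neg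
  · filter_upwards [self_mem_nhdsWithin] with ρ hρ
    exact (integral_div_sqrt_sub_eq hl hderiv hcont hu0 hul hx hρ).symm
  · refine Eventually.of_forall fun ρ => AEStronglyMeasurable.mul ?_ ?_
    · exact (Complex.measurable_ofReal.comp
        ((Real.measurable_renormalizedArsinh ρ).comp hmeas_sub)).aestronglyMeasurable
    · exact (intervalIntegrable_iff.1 hu').aestronglyMeasurable
  · filter_upwards [Ioc_mem_nhdsGT (zero_lt_one' ℝ)] with ρ hρ
    filter_upwards [hne] with s hs _
    rw [norm_mul, Complex.norm_real, Real.norm_eq_abs]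
    gcongr
    exact Real.abs_renormalizedArsinh_le hs hρ.1 hρ.2
  · filter_upwards [hne] with s hs _
    exact ((Complex.continuous_ofReal.tendsto _).comp
      (Real.tendsto_renormalizedArsinh hs)).mul_const _
end
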